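/- arXiv:1705.00181 — 3 statements merged into one kernel-verified Lean document; each statement's English description precedes it below -/
import Mathlib

section
/- Let M be a module such that every factor module of M is finite-dimensional and every nonzero factor module of M contains a nonzero submodule having Krull dimension. Then M has Krull dimension. -/
open MulOpposite

/-- Deviation (Gabriel–Rentschler Krull dimension) of a preorder is `≤ α`:
in every strictly descending chain, all but finitely many of the
intervals (corresponding to successive factor modules) have deviation `< α`. -/
def DevLE (α : Ordinal.{0}) (P : Type) (inst : Preorder P) : Prop :=
  ∀ f : ℕ → P, (∀ n : ℕ, inst.lt (f (n + 1)) (f n)) →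
    ∃ N : ℕ, ∀ n : ℕ, N ≤ n → ∃ β : Ordinal.{0}, ∃ _ : β < α,
      DevLE β {x : P // inst.le (f (n + 1)) x ∧ inst.le x (f n)}
        (@Subtype.preorder P inst fun x => inst.le (f (n + 1)) x ∧ inst.le x (f n))
termination_by α

/-- A preorder has Krull dimension (deviation) if its deviation exists as an ordinal. -/
def HasKdimO (P : Type) [inst : Preorder P] : Prop := ∃ α : Ordinal.{0}, DevLE α P inst

/-- A module has Gabriel–Rentschler Krull dimension: the deviation of its submodule
lattice exists (intervals of this lattice are the submodule lattices of the
subquotients, so this agrees with the transfinite definition via factor modules). -/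
def ModHasKdim (R M : Type) [Ring R] [AddCommGroup M] [Module R M] : Prop :=
  HasKdimO (Submodule R M)

/-- A complete lattice (of submodules/ideals) is finite-dimensional: it contains no
infinite independent family (direct sum) of nonzero elements. -/
def FinDimL (L : Type) [CompleteLattice L] : Prop :=
  ¬ ∃ f : ℕ → L, (∀ n, f n ≠ ⊥) ∧ ∀ n, f n ⊓ (⨆ m, ⨆ _ : m ≠ n, f m) = ⊥

theorem devLE_iff (α : Ordinal.{0}) (P : Type) [inst : Preorder P] :
    DevLE α P inst ↔ ∀ f : ℕ → P, (∀ n, f (n + 1) < f n) →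
      ∃ N : ℕ, ∀ n, N ≤ n → ∃ β < α, DevLE β (Set.Icc (f (n + 1)) (f n)) inferInstance := by
  rw [DevLE]
  simp only [exists_prop]
  rfl

theorem DevLE.of_strictMono {α : Ordinal.{0}} : ∀ {P Q : Type} [Preorder P] [Preorder Q]
    {φ : P → Q}, Monotone φ → StrictMono φ → DevLE α Q inferInstance →
      DevLE α P inferInstance := by
  induction α using WellFoundedLT.induction with
  | ind α ih =>
    intro P Q _ _ φ hm hs hQ
    rw [devLE_iff] at hQ ⊢
    intro f hf
    obtain ⟨N, hN⟩ := hQ (φ ∘ f) fun n => hs (hf n)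
    refine ⟨N, fun n hn => ?_⟩
    obtain ⟨β, hβ, h⟩ := hN n hn
    refine ⟨β, hβ, ih β hβ
      (φ := fun x : Set.Icc (f (n + 1)) (f n) =>
        (⟨φ x, hm x.2.1, hm x.2.2⟩ : Set.Icc ((φ ∘ f) (n + 1)) ((φ ∘ f) n))) ?_ ?_ h⟩
    · exact fun x y hxy => hm hxy
    · exact fun x y hxy => hs hxy

theorem DevLE.mono {α β : Ordinal.{0}} {P : Type} [Preorder P] (hαβ : α ≤ β)
    (h : DevLE α P inferInstance) : DevLE β P inferInstance := by
  rw [devLE_iff] at h ⊢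
  intro f hf
  obtain ⟨N, hN⟩ := h f hf
  refine ⟨N, fun n hn => ?_⟩
  obtain ⟨γ, hγ, h⟩ := hN n hn
  exact ⟨γ, hγ.trans_le hαβ, h⟩

/-- The deviation condition for chains which are only weakly descending. -/
theorem DevLE.exists_of_antitone {α : Ordinal.{0}} {P : Type} [Preorder P]
    (h : DevLE α P inferInstance) {f : ℕ → P} (hf : Antitone f) :
    ∃ N : ℕ, ∀ n, N ≤ n → f (n + 1) < f n →
      ∃ β < α, DevLE β (Set.Icc (f (n + 1)) (f n)) inferInstance := by
  by_contra! hc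
  obtain ⟨φ, hφ, hφc⟩ := Filter.extraction_of_frequently_atTop
    (P := fun n => f (n + 1) < f n ∧
      ∀ β < α, ¬ DevLE β (Set.Icc (f (n + 1)) (f n)) inferInstance)
    (Filter.frequently_atTop.2 hc)
  have hle (k : ℕ) : f (φ (k + 1)) ≤ f (φ k + 1) := hf (hφ (Nat.lt_succ_self k))
  rw [devLE_iff] at h
  obtain ⟨N, hN⟩ := h (f ∘ φ) fun k => (hle k).trans_lt (hφc k).1
  obtain ⟨β, hβ, hd⟩ := hN N le_rfl
  refine (hφc N).2 β hβ (hd.of_strictMono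
    (φ := fun x => ⟨x, (hle N).trans x.2.1, x.2.2⟩) ?_ ?_)
  · exact fun x y hxy => hxy
  · exact fun x y hxy => hxy

theorem devLE_Icc_of_le (α : Ordinal.{0}) {P : Type} [Preorder P] {a b : P} (h : b ≤ a) :
    DevLE α (Set.Icc a b) inferInstance := by
  rw [devLE_iff]
  intro f hf
  have : (f 0 : P) ≤ f 1 := (f 0).2.2.trans (h.trans (f 1).2.1)
  exact absurd (hf 0) (not_lt_of_ge this)

theorem DevLE.prod {α : Ordinal.{0}} : ∀ {P Q : Type} [Preorder P] [Preorder Q],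
    DevLE α P inferInstance → DevLE α Q inferInstance → DevLE α (P × Q) inferInstance := by
  induction α using WellFoundedLT.induction with
  | ind α ih =>
    intro P Q _ _ hP hQ
    rw [devLE_iff]
    intro f hf
    have hf' : Antitone f := antitone_nat_of_succ_le fun n => (hf n).le
    obtain ⟨N₁, h₁⟩ := hP.exists_of_antitone (f := fun n => (f n).1) fun _ _ h => (hf' h).1
    obtain ⟨N₂, h₂⟩ := hQ.exists_of_antitone (f := fun n => (f n).2) fun _ _ h => (hf' h).2
    refine ⟨max N₁ N₂, fun n hn => ?_⟩
    have h₁ := h₁ n ((le_max_left _ _).trans hn)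
    have h₂ := h₂ n ((le_max_right _ _).trans hn)
    have hle := (hf n).le
    suffices ∃ β < α, DevLE β (Set.Icc (f (n + 1)).1 (f n).1) inferInstance ∧
        DevLE β (Set.Icc (f (n + 1)).2 (f n).2) inferInstance by
      obtain ⟨β, hβ, hd₁, hd₂⟩ := this
      refine ⟨β, hβ, (ih β hβ hd₁ hd₂).of_strictMono
        (φ := fun x => (⟨x.1.1, x.2.1.1, x.2.2.1⟩, ⟨x.1.2, x.2.1.2, x.2.2.2⟩)) ?_ ?_⟩
      · exact fun x y hxy => hxy
      · exact fun x y hxy => hxy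
    by_cases c₁ : (f n).1 ≤ (f (n + 1)).1
    · by_cases c₂ : (f n).2 ≤ (f (n + 1)).2
      · exact absurd (hf n) (not_lt_of_ge ⟨c₁, c₂⟩)
      · obtain ⟨β, hβ, hd⟩ := h₂ (lt_of_le_not_ge hle.2 c₂)
        exact ⟨β, hβ, devLE_Icc_of_le β c₁, hd⟩
    · obtain ⟨β, hβ, hd⟩ := h₁ (lt_of_le_not_ge hle.1 c₁)
      by_cases c₂ : (f n).2 ≤ (f (n + 1)).2
      · exact ⟨β, hβ, hd, devLE_Icc_of_le β c₂⟩
      · obtain ⟨γ, hγ, hd'⟩ := h₂ (lt_of_le_not_ge hle.2 c₂)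
        exact ⟨max β γ, max_lt hβ hγ, hd.mono (le_max_left _ _), hd'.mono (le_max_right _ _)⟩

theorem HasKdimO.of_strictMono {P Q : Type} [PartialOrder P] [Preorder Q] {φ : P → Q}
    (hφ : StrictMono φ) (h : HasKdimO Q) : HasKdimO P :=
  h.imp fun _ hα => hα.of_strictMono hφ.monotone hφ

theorem HasKdimO.prod {P Q : Type} [Preorder P] [Preorder Q] (hP : HasKdimO P)
    (hQ : HasKdimO Q) : HasKdimO (P × Q) := by
  obtain ⟨α, hα⟩ := hP
  obtain ⟨β, hβ⟩ := hQ
  exact ⟨max α β, (hα.mono (le_max_left _ _)).prod (hβ.mono (le_max_right _ _))⟩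

theorem hasKdimO_of_forall_chain {P : Type} [Preorder P]
    (h : ∀ f : ℕ → P, (∀ n, f (n + 1) < f n) →
      ∃ N : ℕ, ∀ n, N ≤ n → HasKdimO (Set.Icc (f (n + 1)) (f n))) : HasKdimO P := by
  choose! N hN using h
  choose! α hα using hN
  refine ⟨⨆ p : (ℕ → P) × ℕ, Order.succ (α p.1 p.2), ?_⟩
  rw [devLE_iff]
  refine fun f hf => ⟨N f, fun n hn => ⟨α f n, ?_, hα f hf n hn⟩⟩
  exact (Order.lt_succ _).trans_le
    (Ordinal.le_iSup (fun p : (ℕ → P) × ℕ => Order.succ (α p.1 p.2)) (f, n))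

section Lattice

variable {L : Type} [Lattice L]

theorem HasKdimO.Icc_mono {a b c d : L} (hca : c ≤ a) (hbd : b ≤ d)
    (h : HasKdimO (Set.Icc c d)) : HasKdimO (Set.Icc a b) :=
  h.of_strictMono (φ := fun x => ⟨x, hca.trans x.2.1, x.2.2.trans hbd⟩) fun _ _ hxy => hxy

variable [IsModularLattice L]

theorem HasKdimO.Icc_trans {a b c : L} (hab : a ≤ b) (hbc : b ≤ c)
    (h₁ : HasKdimO (Set.Icc a b)) (h₂ : HasKdimO (Set.Icc b c)) : HasKdimO (Set.Icc a c) :=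
  (h₁.prod h₂).of_strictMono
    (φ := fun x => (⟨x ⊓ b, le_inf x.2.1 hab, inf_le_right⟩,
      ⟨x ⊔ b, le_sup_right, sup_le x.2.2 hbc⟩))
    fun _ _ hxy => strictMono_inf_prod_sup (z := b) hxy

theorem HasKdimO.Icc_sup {a b : L} (h : HasKdimO (Set.Icc (a ⊓ b) b)) :
    HasKdimO (Set.Icc a (a ⊔ b)) :=
  h.of_strictMono (infIccOrderIsoIccSup' a b).symm.strictMono

theorem HasKdimO.Icc_bot_sup [OrderBot L] {a b : L} (ha : HasKdimO (Set.Icc ⊥ a))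
    (hb : HasKdimO (Set.Icc ⊥ b)) : HasKdimO (Set.Icc ⊥ (a ⊔ b)) :=
  ha.Icc_trans bot_le le_sup_left (hb.Icc_mono bot_le le_rfl).Icc_sup

end Lattice

section Module

variable {R M : Type} [Ring R] [AddCommGroup M] [Module R M]

theorem not_finDimL_quotient {A : ℕ → Submodule R M} {B : Submodule R M}
    (hA : ∀ n, ¬ A n ≤ B)
    (hind : ∀ c : ℕ →₀ M, (∀ n, c n ∈ A n) → (c.sum fun _ x => x) ∈ B → ∀ n, c n ∈ B) :
    ¬ FinDimL (Submodule R (M ⧸ B)) := by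
  refine not_not.2 ⟨fun n => (A n).map B.mkQ, fun n h => hA n ?_, fun n => ?_⟩
  · exact (Submodule.map_le_iff_le_comap.1 h.le).trans (Submodule.ker_mkQ B).le
  · simp only [← Submodule.map_iSup]
    rw [eq_bot_iff]
    rintro _ ⟨⟨x, hx, rfl⟩, y, hy, hxy⟩
    obtain ⟨c, hc, rfl⟩ := (Submodule.mem_iSup_iff_exists_finsupp _ _).1 hy
    have hcA (m : ℕ) : c m ∈ A m := (iSup_le fun _ => le_rfl : ⨆ _ : m ≠ n, A m ≤ A m) (hc m)
    have hcn : c n = 0 := by simpa using hc n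
    have key := hind (Finsupp.single n x - c) (fun m => ?_) ?_ n
    · simpa [hcn] using key
    · refine sub_mem ?_ (hcA m)
      rw [Finsupp.single_apply]
      split_ifs with h
      · exact h ▸ hx
      · exact zero_mem _
    · rw [Finsupp.sum_sub_index fun _ _ _ => rfl, Finsupp.sum_single_index rfl]
      exact (Submodule.Quotient.eq B).1 hxy.symm

/-- A submodule all of whose cyclic submodules have Krull dimension has Krull dimension itself,
provided that all factor modules are finite-dimensional. -/
theorem hasKdimO_Icc_of_forall_span
    (hfd : ∀ N : Submodule R M, FinDimL (Submodule R (M ⧸ N))) {X : Submodule R M}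
    (hX : ∀ x ∈ X, HasKdimO (Set.Icc ⊥ (R ∙ x))) : HasKdimO (Set.Icc ⊥ X) := by
  refine hasKdimO_of_forall_chain fun f hf => ?_
  by_contra! hc
  obtain ⟨φ, hφ, hφc⟩ := Filter.extraction_of_frequently_atTop (Filter.frequently_atTop.2 hc)
  have hf' : Antitone f := antitone_nat_of_succ_le fun n => (hf n).le
  let D : ℕ → Submodule R M := fun i => f (φ i)
  have hD : Antitone D := fun i j hij => hf' (hφ.monotone hij)
  have hDc (i : ℕ) : ¬ HasKdimO (Set.Icc (D (i + 1)) (D i)) := fun h => hφc i <|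
    h.of_strictMono (φ := fun x => ⟨x, (hf' (hφ (Nat.lt_succ_self i)) :
      f (φ (i + 1)) ≤ f (φ i + 1)).trans x.2.1, x.2.2⟩) fun _ _ hxy => hxy
  have hex (i : ℕ) (S : Submodule R M) (hS : HasKdimO (Set.Icc ⊥ S)) :
      ∃ a ∈ D i, a ∉ D (i + 1) ⊔ S := by
    by_contra! hle
    exact hDc i ((hS.Icc_mono bot_le le_rfl).Icc_sup.Icc_mono le_rfl hle)
  choose! a haD ha using hex
  let S : ℕ → Submodule R M :=
    fun n => n.rec ⊥ fun i s => s ⊔ (R ∙ a i s) ⊓ (D (i + 1) ⊔ s)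
  have hSsucc (i : ℕ) : S (i + 1) = S i ⊔ (R ∙ a i (S i)) ⊓ (D (i + 1) ⊔ S i) := rfl
  have hSK (i : ℕ) : HasKdimO (Set.Icc ⊥ (S i)) := by
    induction i with
    | zero => exact ⟨0, devLE_Icc_of_le 0 le_rfl⟩
    | succ i ih =>
      rw [hSsucc]
      exact ih.Icc_bot_sup ((hX _ ((f (φ i)).2.2 (haD i _ ih))).Icc_mono le_rfl inf_le_left)
  have hSmono : Monotone S := monotone_nat_of_le_succ fun i => le_sup_left
  have haD' (i : ℕ) : (R ∙ a i (S i)) ≤ D i :=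
    (Submodule.span_singleton_le_iff_mem _ _).2 (haD i _ (hSK i))
  have hSD (i j : ℕ) (hij : i ≤ j) : S j ≤ D (i + 1) ⊔ S i := by
    induction j, hij using Nat.le_induction with
    | base => exact le_sup_right
    | succ j hij ih =>
      rw [hSsucc]
      refine sup_le ih (inf_le_right.trans (sup_le ?_ ih))
      exact (hD (Nat.succ_le_succ hij)).trans le_sup_left
  have hBD (i : ℕ) : ⨆ j, S j ≤ D (i + 1) ⊔ S i := iSup_le fun j =>
    (le_total i j).elim (hSD i j) fun h => (hSmono h).trans le_sup_right
  refine not_finDimL_quotient (A := fun i => R ∙ a i (S i)) (B := ⨆ j, S j) (fun i h => ?_)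
    (fun c hcA hcB => ?_) (hfd _)
  · exact ha i _ (hSK i) (hBD i (h (Submodule.mem_span_singleton_self _)))
  · suffices ∀ n, c n ∈ S (n + 1) from fun n => le_iSup S (n + 1) (this n)
    intro n
    induction n using Nat.strong_induction_on with
    | _ n ih =>
      rw [hSsucc]
      refine Submodule.mem_sup_right ⟨hcA n, ?_⟩
      have hother (j : ℕ) (hj : j ≠ n) : c j ∈ D (n + 1) ⊔ S n := by
        rcases lt_or_gt_of_ne hj with h | h
        · exact Submodule.mem_sup_right (hSmono h (ih j h))
        · exact Submodule.mem_sup_left (hD h (haD' j (hcA j)))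
      have hsum := hBD n hcB
      by_cases hn : n ∈ c.support
      · rw [Finsupp.sum, ← Finset.add_sum_erase _ _ hn] at hsum
        refine (Submodule.add_mem_iff_left _ (sum_mem fun j hj => ?_)).1 hsum
        exact hother j (Finset.ne_of_mem_erase hj)
      · rw [Finsupp.notMem_support_iff.1 hn]
        exact zero_mem _

/-- The submodule of all elements generating a cyclic submodule with Krull dimension. -/
def kdimRadical (R M : Type) [Ring R] [AddCommGroup M] [Module R M] : Submodule R M where
  carrier := {x | HasKdimO (Set.Icc ⊥ (R ∙ x))}
  zero_mem' := ⟨0, devLE_Icc_of_le 0 (by simp)⟩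
  add_mem' {x y} hx hy := (hx.Icc_bot_sup hy).Icc_mono le_rfl <|
    (Submodule.span_singleton_le_iff_mem _ _).2 <|
      Submodule.add_mem_sup (Submodule.mem_span_singleton_self x)
        (Submodule.mem_span_singleton_self y)
  smul_mem' r x hx := HasKdimO.Icc_mono le_rfl (Submodule.span_singleton_smul_le R r x) hx

theorem ModHasKdim.Icc_comap_mkQ {N : Submodule R M} {X : Submodule R (M ⧸ N)}
    (h : ModHasKdim R X) : HasKdimO (Set.Icc N (X.comap N.mkQ)) := by
  refine HasKdimO.of_strictMono
    (φ := fun Y : Set.Icc N (X.comap N.mkQ) => (Y.1.map N.mkQ).comap X.subtype)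
    (Monotone.strictMono_of_injective ?_ ?_) h
  · exact fun Y Z hYZ => Submodule.comap_mono (Submodule.map_mono hYZ)
  · intro Y Z hYZ
    have key (W : Set.Icc N (X.comap N.mkQ)) :
        (((W.1.map N.mkQ).comap X.subtype).map X.subtype).comap N.mkQ = W.1 := by
      rw [Submodule.map_comap_subtype,
        inf_eq_right.2 (Submodule.map_le_iff_le_comap.2 W.2.2), Submodule.comap_map_mkQ,
        sup_eq_right.2 W.2.1]
    apply Subtype.ext
    rw [← key Y, ← key Z]
    exact congrArg (fun V : Submodule R X => (V.map X.subtype).comap N.mkQ) hYZ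

end Module

theorem stmt8 (R M : Type) [Ring R] [AddCommGroup M] [Module R M]
    (hfd : ∀ N : Submodule R M, FinDimL (Submodule R (M ⧸ N)))
    (hsub : ∀ N : Submodule R M, N ≠ ⊤ →
      ∃ X : Submodule R (M ⧸ N), X ≠ ⊥ ∧ ModHasKdim R X) :
    ModHasKdim R M := by
  have hK : HasKdimO (Set.Icc ⊥ (kdimRadical R M)) :=
    hasKdimO_Icc_of_forall_span hfd fun _ hx => hx
  have htop : kdimRadical R M = ⊤ := by
    by_contra hne
    obtain ⟨X, hX, hXK⟩ := hsub _ hne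
    have hle : kdimRadical R M ≤ X.comap (kdimRadical R M).mkQ := Submodule.le_comap_mkQ _ _
    have hXK' := hK.Icc_trans bot_le hle hXK.Icc_comap_mkQ
    refine hX (eq_bot_iff.2 fun y hy => ?_)
    obtain ⟨x, rfl⟩ := Submodule.mkQ_surjective _ y
    have hx : x ∈ kdimRadical R M := hXK'.Icc_mono le_rfl <|
      (Submodule.span_singleton_le_iff_mem _ _).2 hy
    exact (Submodule.Quotient.mk_eq_zero _).2 hx
  rw [htop] at hK
  exact hK.of_strictMono (φ := fun Y => ⟨Y, bot_le, le_top⟩) fun _ _ hxy => hxy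
end

section
/- Let A be a ring with right Krull dimension and B a proper ideal of A. Then there exist prime ideals P₁, ..., Pₙ of A, each containing B, such that P₁ ⋯ Pₙ ⊆ B. -/
open MulOpposite

/-- A right ideal is two-sided if it is also closed under left multiplication. -/
def IsTwoSidedR {A : Type} [Ring A] (I : Submodule Aᵐᵒᵖ A) : Prop :=
  ∀ a ∈ I, ∀ b : A, b * a ∈ I

/-- A prime (two-sided) ideal of a ring, element-wise characterization. -/
def IsPrime2 {A : Type} [Ring A] (P : Submodule Aᵐᵒᵖ A) : Prop :=
  IsTwoSidedR P ∧ P ≠ ⊤ ∧ ∀ a b : A, (∀ x : A, a * x * b ∈ P) → a ∈ P ∨ b ∈ P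

/-- A preorder with deviation carries no nonempty relation that refines `<` and along which
every pair can be split. -/
theorem DevLE.not_rel_of_split (α : Ordinal.{0}) : ∀ (P : Type) (inst : Preorder P),
    DevLE α P inst → ∀ R : P → P → Prop,
    (∀ a b, R a b → a < b ∧ ∃ c, R a c ∧ R c b) → ∀ a b, ¬ R a b := by
  induction α using WellFoundedLT.induction with
  | ind α ih =>
    intro P inst h R hR a b hab
    rw [DevLE] at h
    have step : ∀ x : {x // R a x}, ∃ y : {y // R a y}, R y x := fun x => by
      obtain ⟨-, c, h1, h2⟩ := hR _ _ x.2
      exact ⟨⟨c, h1⟩, h2⟩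
    choose s hs using step
    let f : ℕ → {x // R a x} := fun n => s^[n] ⟨b, hab⟩
    have hf : ∀ n, R (f (n + 1)) (f n) := fun n => by
      simp only [f, Function.iterate_succ_apply']
      exact hs _
    obtain ⟨N, hN⟩ := h (fun n => (f n).1) (fun n => (hR _ _ (hf n)).1)
    obtain ⟨β, hβ, hd⟩ := hN N le_rfl
    refine ih β hβ _ _ hd (fun x y => R x y) ?_
      ⟨(f (N + 1)).1, le_rfl, (hR _ _ (hf N)).1.le⟩
      ⟨(f N).1, (hR _ _ (hf N)).1.le, le_rfl⟩ (hf N)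
    rintro ⟨x, hx⟩ ⟨y, hy⟩ hxy
    obtain ⟨hlt, c, h1, h2⟩ := hR _ _ hxy
    exact ⟨hlt, ⟨c, hx.1.trans (hR _ _ h1).1.le, (hR _ _ h2).1.le.trans hy.2⟩, h1, h2⟩

/-- An invariant of finite lists that can always be extended yields an infinite sequence whose
terms are pairwise related, when the invariant controls terms and pairs. -/
theorem exists_seq_of_list_extension {α : Type*} (Inv : List α → Prop) (p : α → Prop)
    (r : α → α → Prop) (hp : ∀ l, Inv l → ∀ x ∈ l, p x) (hr : ∀ l, Inv l → l.Pairwise r)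
    (h0 : Inv []) (hs : ∀ l, Inv l → ∃ x, Inv (x :: l)) :
    ∃ f : ℕ → α, (∀ n, p (f n)) ∧ ∀ m n, m < n → r (f n) (f m) := by
  have : Nonempty α := ⟨(hs [] h0).choose⟩
  choose! s hs using hs
  let L : ℕ → List α := fun n => (fun l => s l :: l)^[n] []
  have hL : ∀ n, L (n + 1) = s (L n) :: L n := fun n => by
    simp only [L, Function.iterate_succ_apply']
  have hI : ∀ n, Inv (L n) := fun n => by
    induction n with
    | zero => exact h0
    | succ n ih => rw [hL]; exact hs _ ih
  have hmem : ∀ m n, m < n → s (L m) ∈ L n := fun m n hmn => by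
    induction n with
    | zero => omega
    | succ n ih =>
      rw [hL]
      rcases Nat.lt_succ_iff_lt_or_eq.1 hmn with h | rfl
      · exact List.mem_cons_of_mem _ (ih h)
      · exact List.mem_cons_self
  refine ⟨fun n => s (L n), fun n => hp _ (hI (n + 1)) _ (hmem _ _ n.lt_succ_self), ?_⟩
  intro m n hmn
  have := hr _ (hI (n + 1))
  rw [hL, List.pairwise_cons] at this
  exact this.1 _ (hmem _ _ hmn)

section PrimeProducts

variable {A : Type} [Ring A]

theorem mul_mem_of_rightIdeal (I : Submodule Aᵐᵒᵖ A) {x : A} (hx : x ∈ I) (r : A) :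
    x * r ∈ I := I.smul_mem (op r) hx

/-- A biorthogonal sequence of elements, relative to right ideals, obstructs right Krull
dimension. -/
theorem HasKdimO.not_biorthogonal (h : HasKdimO (Submodule Aᵐᵒᵖ A)) (x a : ℕ → A)
    (G : ℕ → Submodule Aᵐᵒᵖ A) (hd : ∀ i, x i * a i ∉ G i)
    (ho : ∀ i j, i ≠ j → x i * a j ∈ G i) : False := by
  obtain ⟨α, h⟩ := h
  obtain ⟨e⟩ : Nonempty (ℚ ≃ ℕ) := nonempty_equiv_of_countable
  let D : ℚ → Submodule Aᵐᵒᵖ A := fun q =>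
    { carrier := {b | ∀ p, q ≤ p → x (e p) * b ∈ G (e p)}
      add_mem' := fun hb hc p hp => by
        rw [mul_add]; exact add_mem (hb p hp) (hc p hp)
      zero_mem' := fun p _ => by simp
      smul_mem' := fun r b hb p hp => by
        have := (G (e p)).smul_mem r (hb p hp)
        rwa [← mul_smul_comm] at this }
  have hD : ∀ p q, p < q → D p < D q := fun p q hpq => by
    refine lt_of_le_of_ne (fun b hb t ht => hb t (hpq.le.trans ht)) fun heq => ?_
    have : a (e p) ∈ D q := fun t ht => ho _ _ fun h' => by
      have := e.injective h'
      subst this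
      exact absurd hpq (not_lt.2 ht)
    rw [← heq] at this
    exact hd _ (this p le_rfl)
  refine DevLE.not_rel_of_split α _ _ h (fun I K => ∃ p q, p < q ∧ I = D p ∧ K = D q) ?_
    (D 0) (D 1) ⟨0, 1, zero_lt_one, rfl, rfl⟩
  rintro _ _ ⟨p, q, hpq, rfl, rfl⟩
  obtain ⟨t, h1, h2⟩ := exists_between hpq
  exact ⟨hD _ _ hpq, D t, ⟨p, t, h1, rfl, rfl⟩, ⟨t, q, h2, rfl, rfl⟩⟩

/-- The right ideal `c` contains a product of finitely many primes, each containing `B`. -/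
def ContainsPrimeProd (B c : Submodule Aᵐᵒᵖ A) : Prop :=
  ∃ L : List (Submodule Aᵐᵒᵖ A), (∀ P ∈ L, IsPrime2 P ∧ B ≤ P) ∧
    ∀ g : List A, List.Forall₂ (fun x P => x ∈ P) g L → g.prod ∈ c

variable {B c d e I J K : Submodule Aᵐᵒᵖ A}

theorem containsPrimeProd_top : ContainsPrimeProd B ⊤ := ⟨[], by simp, by simp⟩

theorem ContainsPrimeProd.mul (hc : ContainsPrimeProd B c) (hd : ContainsPrimeProd B d)
    (h : ∀ x ∈ c, ∀ y ∈ d, x * y ∈ e) : ContainsPrimeProd B e := by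
  obtain ⟨L, hL, h1⟩ := hc
  obtain ⟨L', hL', h2⟩ := hd
  refine ⟨L ++ L', fun P hP => (List.mem_append.1 hP).elim (hL P) (hL' P), fun g hg => ?_⟩
  rw [← List.take_append_drop L.length g, List.prod_append]
  exact h _ (h1 _ (List.forall₂_take_append g L L' hg))
    _ (h2 _ (List.forall₂_drop_append g L L' hg))

theorem ContainsPrimeProd.mono (hc : ContainsPrimeProd B c) (h : c ≤ d) :
    ContainsPrimeProd B d :=
  hc.mul containsPrimeProd_top fun _ hx y _ => h (mul_mem_of_rightIdeal c hx y)

theorem exists_mul_mem_of_not_containsPrimeProd (hc : IsTwoSidedR c) (hB : B ≤ c)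
    (h : ¬ ContainsPrimeProd B c) :
    ∃ a b, a ∉ c ∧ b ∉ c ∧ ∀ x, a * x * b ∈ c := by
  by_contra! hn
  refine h ⟨[c], ?_, ?_⟩
  · intro P hP
    rw [List.mem_singleton.1 hP]
    refine ⟨⟨hc, fun ht => h (ht ▸ containsPrimeProd_top), fun a b hab => ?_⟩, hB⟩
    by_contra! hab'
    obtain ⟨x, hx⟩ := hn a b hab'.1 hab'.2
    exact hx (hab x)
  · intro g hg
    cases hg with
    | cons h1 h2 => cases h2; simpa using h1

/-- The ideal of elements carrying the right ideal `K` into `I` by right multiplication. -/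
def transporter (I K : Submodule Aᵐᵒᵖ A) : Submodule Aᵐᵒᵖ A where
  carrier := {a | ∀ k ∈ K, k * a ∈ I}
  add_mem' ha hb k hk := by rw [mul_add]; exact add_mem (ha k hk) (hb k hk)
  zero_mem' k _ := by simp
  smul_mem' r b hb k hk := by
    have := I.smul_mem r (hb k hk)
    rwa [← mul_smul_comm] at this

theorem mem_transporter {a : A} : a ∈ transporter I K ↔ ∀ k ∈ K, k * a ∈ I := Iff.rfl

theorem isTwoSidedR_transporter : IsTwoSidedR (transporter I K) := fun a ha b k hk => by
  rw [← mul_assoc]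
  exact ha _ (mul_mem_of_rightIdeal K hk b)

theorem le_transporter (hB : IsTwoSidedR B) (h : B ≤ I) : B ≤ transporter I K :=
  fun b hb k _ => h (hB b hb k)

/-- A subquotient `K / I` is annihilated by a product of primes containing `B`. -/
def PrimeProdKills (B I K : Submodule Aᵐᵒᵖ A) : Prop :=
  ContainsPrimeProd B (transporter I K)

theorem PrimeProdKills.trans (h1 : PrimeProdKills B I J) (h2 : PrimeProdKills B J K) :
    PrimeProdKills B I K :=
  ContainsPrimeProd.mul h2 h1 fun x hx y hy k hk => by
    rw [← mul_assoc]
    exact hy _ (hx k hk)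

theorem PrimeProdKills.mono {I' K' : Submodule Aᵐᵒᵖ A} (h : PrimeProdKills B I K)
    (hI : I ≤ I') (hK : K' ≤ K) : PrimeProdKills B I' K' :=
  ContainsPrimeProd.mono h fun _ ha k hk => hI (ha k (hK hk))

theorem exists_mul_mem_of_not_primeProdKills (hB : IsTwoSidedR B) (hI : B ≤ I)
    (h : ¬ PrimeProdKills B I K) :
    ∃ a b, a ∉ transporter I K ∧ b ∉ transporter I K ∧ ∀ x, a * x * b ∈ transporter I K :=
  exists_mul_mem_of_not_containsPrimeProd isTwoSidedR_transporter (le_transporter hB hI) h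

/-- The right ideal generated by `K * s`. -/
def mulSpan (K : Submodule Aᵐᵒᵖ A) (s : Set A) : Submodule Aᵐᵒᵖ A :=
  Submodule.span Aᵐᵒᵖ {y | ∃ k ∈ K, ∃ a ∈ s, y = k * a}

theorem mul_mem_mulSpan {s : Set A} {k a : A} (hk : k ∈ K) (ha : a ∈ s) :
    k * a ∈ mulSpan K s := Submodule.subset_span ⟨k, hk, a, ha, rfl⟩

theorem mem_transporter_mulSpan {s : Set A} {b : A} :
    b ∈ transporter I (mulSpan K s) ↔ ∀ k ∈ K, ∀ a ∈ s, ∀ r, k * a * r * b ∈ I := by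
  refine ⟨fun h k hk a ha r => h _ (mul_mem_of_rightIdeal _ (mul_mem_mulSpan hk ha) r),
    fun h y hy => ?_⟩
  suffices ∀ r, y * r * b ∈ I by simpa using this 1
  unfold mulSpan at hy
  induction hy using Submodule.span_induction with
  | mem y hy => obtain ⟨k, hk, a, ha, rfl⟩ := hy; exact h k hk a ha
  | zero => simp
  | add y z _ _ h1 h2 => intro r; rw [add_mul, add_mul]; exact add_mem (h1 r) (h2 r)
  | smul t y _ h1 =>
    intro r
    have : t • y * r = y * (t.unop * r) := by
      rw [← mul_assoc]; rfl
    rw [this]; exact h1 _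

theorem mulSpan_le {s : Set A} (h : ∀ k ∈ K, ∀ a ∈ s, k * a ∈ I) : mulSpan K s ≤ I :=
  Submodule.span_le.2 fun _ ⟨k, hk, a, ha, hy⟩ => hy ▸ h k hk a ha

/-- Finitely many containments `S p * c ⊆ T p` can be achieved by a single ideal `c`
containing a product of primes. -/
theorem exists_common_containsPrimeProd {ι : Type*} (S T : ι → Submodule Aᵐᵒᵖ A) (l : List ι)
    (h : ∀ p ∈ l, PrimeProdKills B (T p) (S p)) :
    ∃ c : Submodule Aᵐᵒᵖ A, IsTwoSidedR c ∧ ContainsPrimeProd B c ∧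
      ∀ p ∈ l, c ≤ transporter (T p) (S p) := by
  induction l with
  | nil => exact ⟨⊤, fun _ _ _ => trivial, containsPrimeProd_top, by simp⟩
  | cons p l ih =>
    obtain ⟨c, h1, h2, h3⟩ := ih fun q hq => h q (List.mem_cons_of_mem _ hq)
    refine ⟨c ⊓ transporter (T p) (S p),
      fun a ha b => ⟨h1 a ha.1 b, isTwoSidedR_transporter a ha.2 b⟩,
      h2.mul (h p List.mem_cons_self) fun x hx y hy =>
        ⟨mul_mem_of_rightIdeal c hx y, isTwoSidedR_transporter y hy x⟩, ?_⟩
    intro q hq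
    rcases List.mem_cons.1 hq with rfl | hq
    · exact inf_le_right
    · exact inf_le_left.trans (h3 q hq)

/-- Two triples `(x, a, G)` are orthogonal if each `x` multiplies the other `a` into its `G`. -/
def Orthogonal (p q : A × A × Submodule Aᵐᵒᵖ A) : Prop :=
  p.1 * q.2.1 ∈ p.2.2 ∧ q.1 * p.2.1 ∈ q.2.2

theorem HasKdimO.not_extendable (h : HasKdimO (Submodule Aᵐᵒᵖ A))
    (Inv : List (A × A × Submodule Aᵐᵒᵖ A) → Prop)
    (hd : ∀ l, Inv l → ∀ p ∈ l, p.1 * p.2.1 ∉ p.2.2)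
    (ho : ∀ l, Inv l → l.Pairwise Orthogonal) (h0 : Inv [])
    (hs : ∀ l, Inv l → ∃ p, Inv (p :: l)) : False := by
  obtain ⟨f, h1, h2⟩ := exists_seq_of_list_extension Inv _ _ hd ho h0 hs
  refine h.not_biorthogonal (fun n => (f n).1) (fun n => (f n).2.1) (fun n => (f n).2.2) h1 ?_
  intro i j hij
  rcases lt_or_gt_of_ne hij with hlt | hlt
  · exact (h2 _ _ hlt).2
  · exact (h2 _ _ hlt).1

/-- One extension step for torsion subquotients. -/
theorem exists_orthogonal_step (hB : IsTwoSidedR B) (hJ : B ≤ J) {U : Submodule Aᵐᵒᵖ A}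
    (hU : ¬ PrimeProdKills B J U) (hc : ContainsPrimeProd B c) :
    ∃ x ∈ U, ∃ a ∈ c, x * a ∉ J ∧ ∃ U' ≤ U, ∃ J' ≥ J,
      ¬ PrimeProdKills B J' U' ∧ ∀ u ∈ U', u * a ∈ J' := by
  set V := mulSpan U (c : Set A) with hV
  have hVU : V ≤ U := mulSpan_le fun k hk a _ => mul_mem_of_rightIdeal U hk a
  have hVb : ¬ PrimeProdKills B J V := fun hk => hU <| by
    refine ContainsPrimeProd.mul hc hk fun x hx y hy u hu => ?_
    rw [← mul_assoc]
    exact hy _ (mul_mem_mulSpan hu hx)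
  have key : ∀ a, a ∉ transporter J V → ∃ u ∈ U, ∃ k ∈ c, u * (k * a) ∉ J := fun a ha => by
    rw [hV, mem_transporter_mulSpan] at ha
    push Not at ha
    obtain ⟨u, hu, k, hk, r, h⟩ := ha
    exact ⟨u, hu, k * r, mul_mem_of_rightIdeal c hk r, by simpa only [mul_assoc] using h⟩
  obtain ⟨a, b, ha, hb, hab⟩ := exists_mul_mem_of_not_primeProdKills hB hJ hVb
  by_cases hW : PrimeProdKills B J (mulSpan V {a})
  · obtain ⟨u, hu, k, hk, hn⟩ := key a ha
    refine ⟨u, hu, k * a, mul_mem_of_rightIdeal c hk a, hn, V, hVU,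
      J ⊔ mulSpan V {a}, le_sup_left, fun hk' => hVb ?_, fun v hv => ?_⟩
    · refine PrimeProdKills.trans ?_ hk'
      refine ContainsPrimeProd.mono hW fun y hy z hz => ?_
      obtain ⟨j, hj, w, hw, rfl⟩ := Submodule.mem_sup.1 hz
      rw [add_mul]
      exact add_mem (mul_mem_of_rightIdeal J hj y) (hy w hw)
    · rw [← mul_assoc]
      exact le_sup_right (a := J)
        (mul_mem_mulSpan (mul_mem_of_rightIdeal V hv k) (Set.mem_singleton a))
  · obtain ⟨u, hu, k, hk, hn⟩ := key b hb
    refine ⟨u, hu, k * b, mul_mem_of_rightIdeal c hk b, hn, mulSpan V {a},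
      (mulSpan_le fun v hv a _ => mul_mem_of_rightIdeal V hv a).trans hVU, J, le_rfl, hW, ?_⟩
    refine mem_transporter.1 (mem_transporter_mulSpan.2 ?_)
    rintro v hv _ rfl r
    have := hab (r * k) v hv
    simpa only [mul_assoc] using this

/-- If every element of `K` is carried into `I` by a product of primes, a single product
does so for all of `K`. -/
theorem primeProdKills_of_torsion (h : HasKdimO (Submodule Aᵐᵒᵖ A)) (hB : IsTwoSidedR B)
    (hI : B ≤ I) (ht : ∀ x ∈ K, PrimeProdKills B I (Submodule.span Aᵐᵒᵖ {x})) :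
    PrimeProdKills B I K := by
  by_contra hK
  refine h.not_extendable (fun l => l.Pairwise Orthogonal ∧
    (∀ p ∈ l, p.1 * p.2.1 ∉ p.2.2 ∧ p.1 ∈ K ∧ I ≤ p.2.2) ∧
    ∃ U J, I ≤ J ∧ U ≤ K ∧ ¬ PrimeProdKills B J U ∧ ∀ p ∈ l, ∀ u ∈ U, u * p.2.1 ∈ J)
    (fun l hl p hp => (hl.2.1 p hp).1) (fun l hl => hl.1)
    ⟨List.Pairwise.nil, by simp, K, I, le_rfl, le_rfl, hK, by simp⟩ ?_
  rintro l ⟨ho, hl, U, J, hIJ, hUK, hUJ, hs⟩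
  obtain ⟨c, -, hc, hcl⟩ := exists_common_containsPrimeProd (B := B)
    (fun p : A × A × Submodule Aᵐᵒᵖ A => Submodule.span Aᵐᵒᵖ {p.1}) (fun _ => I) l
    fun p hp => ht _ (hl p hp).2.1
  obtain ⟨x, hx, a, ha, hn, U', hU', J', hJ', hb, hz⟩ :=
    exists_orthogonal_step hB (hI.trans hIJ) hUJ hc
  refine ⟨(x, a, J), List.pairwise_cons.2 ⟨fun p hp => ⟨hs p hp x hx, ?_⟩, ho⟩, ?_,
    U', J', hIJ.trans hJ', hU'.trans hUK, hb, ?_⟩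
  · exact (hl p hp).2.2 (hcl p hp ha _ (Submodule.mem_span_singleton_self _))
  · intro p hp
    rcases List.mem_cons.1 hp with rfl | hp
    · exact ⟨hn, hUK hx, hIJ⟩
    · exact hl p hp
  · intro p hp u hu
    rcases List.mem_cons.1 hp with rfl | hp
    · exact hz u hu
    · exact hJ' (hs p hp u (hU' hu))

/-- Gaussian elimination against a list of orthogonal triples. -/
theorem exists_orthogonal_correction (T : Submodule Aᵐᵒᵖ A) (b : A)
    (l : List (A × A × Submodule Aᵐᵒᵖ A)) (ho : l.Pairwise Orthogonal)
    (hT : ∀ p ∈ l, p.2.2 = T)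
    (hb : ∀ p ∈ l, ∃ s, p.1 * b - p.1 * p.2.1 * s ∈ T) :
    ∃ w, (∀ x : A, (∀ p ∈ l, x * p.2.1 ∈ T) → x * w ∈ T) ∧
      ∀ p ∈ l, p.1 * (b - w) ∈ T := by
  induction l with
  | nil => exact ⟨0, by simp, by simp⟩
  | cons p l ih =>
    rw [List.pairwise_cons] at ho
    obtain ⟨w, hw, hwl⟩ := ih ho.2 (fun q hq => hT q (List.mem_cons_of_mem _ hq))
      (fun q hq => hb q (List.mem_cons_of_mem _ hq))
    obtain ⟨s, hs⟩ := hb p List.mem_cons_self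
    have hpT := hT p List.mem_cons_self
    refine ⟨w + p.2.1 * s, fun x hx => ?_, fun q hq => ?_⟩
    · rw [mul_add, ← mul_assoc]
      exact add_mem (hw x fun q hq => hx q (List.mem_cons_of_mem _ hq))
        (mul_mem_of_rightIdeal T (hx p List.mem_cons_self) s)
    · rcases List.mem_cons.1 hq with rfl | hq
      · have h1 : q.1 * w ∈ T := hw _ fun t ht => hpT ▸ (ho.1 t ht).1
        have : q.1 * (b - (w + q.2.1 * s)) = (q.1 * b - q.1 * q.2.1 * s) - q.1 * w := by
          noncomm_ring
        rw [this]
        exact sub_mem hs h1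
      · have h1 : q.1 * p.2.1 ∈ T := by
          have := (ho.1 q hq).2
          rwa [hT q (List.mem_cons_of_mem _ hq)] at this
        have : q.1 * (b - (w + p.2.1 * s)) = q.1 * (b - w) - q.1 * p.2.1 * s := by
          noncomm_ring
        rw [this]
        exact sub_mem (hwl q hq) (mul_mem_of_rightIdeal T h1 s)

/-- A subquotient `K / T` without nonzero subobjects killed by products of primes, all of whose
proper quotients are killed by such products, cannot be nonzero. -/
theorem le_of_torsionFree_of_quotients (h : HasKdimO (Submodule Aᵐᵒᵖ A)) (hB : IsTwoSidedR B)
    {T : Submodule Aᵐᵒᵖ A} (hT : B ≤ T) (hTK : T ≤ K)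
    (hf : ∀ J ≤ K, PrimeProdKills B T J → J ≤ T)
    (hq : ∀ J ≤ K, T ≤ J → ¬ J ≤ T → PrimeProdKills B J K) : K ≤ T := by
  by_contra hK
  refine h.not_extendable (fun l => l.Pairwise Orthogonal ∧
    (∀ p ∈ l, p.1 * p.2.1 ∉ p.2.2 ∧ p.1 ∈ K ∧ p.2.2 = T) ∧
    ∃ J ≤ K, ¬ J ≤ T ∧ ∀ p ∈ l, ∀ u ∈ J, u * p.2.1 ∈ T)
    (fun l hl p hp => (hl.2.1 p hp).1) (fun l hl => hl.1)
    ⟨List.Pairwise.nil, by simp, K, le_rfl, hK, by simp⟩ ?_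
  rintro l ⟨ho, hl, J, hJK, hJT, hs⟩
  obtain ⟨a, b, ha, hb, hab⟩ := exists_mul_mem_of_not_primeProdKills hB hT
    fun hk => hJT (hf J hJK hk)
  obtain ⟨x, hx, hxb⟩ : ∃ x ∈ J, x * b ∉ T := by
    simpa [mem_transporter] using hb
  have hJ'b : ∀ u ∈ mulSpan J {a}, u * b ∈ T := by
    refine mem_transporter.1 (mem_transporter_mulSpan.2 ?_)
    rintro v hv _ rfl r
    simpa only [mul_assoc] using hab r v hv
  have hJ'J : mulSpan J {a} ≤ J := mulSpan_le fun v hv a _ => mul_mem_of_rightIdeal J hv a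
  have hJ'T : ¬ mulSpan J {a} ≤ T := fun hle =>
    ha fun u hu => hle (mul_mem_mulSpan hu (Set.mem_singleton a))
  obtain ⟨c, hc2, hc, hcl⟩ := exists_common_containsPrimeProd (B := B)
    (fun _ => K)
    (fun p : A × A × Submodule Aᵐᵒᵖ A => T ⊔ Submodule.span Aᵐᵒᵖ {p.1 * p.2.1}) l
    fun p hp => by
      obtain ⟨h1, h2, h3⟩ := hl p hp
      refine hq _ (sup_le hTK ?_) le_sup_left fun hle => h1 ?_
      · rw [Submodule.span_singleton_le_iff_mem]
        exact mul_mem_of_rightIdeal K h2 _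
      · rw [h3]
        exact hle (le_sup_right (a := T) (Submodule.mem_span_singleton_self _))
  obtain ⟨r, hr, hxbr⟩ : ∃ r ∈ c, x * b * r ∉ T := by
    by_contra! hn
    refine hxb (hf (Submodule.span Aᵐᵒᵖ {x * b}) ?_ (hc.mono fun r hr y hy => ?_)
      (Submodule.mem_span_singleton_self _))
    · rw [Submodule.span_singleton_le_iff_mem]
      exact mul_mem_of_rightIdeal K (hJK hx) b
    · obtain ⟨t, rfl⟩ := Submodule.mem_span_singleton.1 hy
      have := hn _ (hc2 r hr t.unop)
      rwa [← mul_assoc] at this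
  obtain ⟨w, hw, hwl⟩ := exists_orthogonal_correction T (b * r) l ho
    (fun p hp => (hl p hp).2.2) fun p hp => by
      have := hcl p hp hr _ (mul_mem_of_rightIdeal K (hl p hp).2.1 b)
      obtain ⟨t, ht, y, hy, hty⟩ := Submodule.mem_sup.1 this
      obtain ⟨s, rfl⟩ := Submodule.mem_span_singleton.1 hy
      refine ⟨s.unop, ?_⟩
      rw [← mul_assoc, ← hty]
      change t + p.1 * p.2.1 * s.unop - p.1 * p.2.1 * s.unop ∈ T
      rwa [add_sub_cancel_right]
  have hwJ : ∀ u ∈ J, u * w ∈ T := fun u hu => hw u fun p hp => hs p hp u hu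
  refine ⟨(x, b * r - w, T), List.pairwise_cons.2 ⟨fun p hp => ⟨hs p hp x hx, ?_⟩, ho⟩, ?_,
    mulSpan J {a}, hJ'J.trans hJK, hJ'T, ?_⟩
  · rw [(hl p hp).2.2]
    exact hwl p hp
  · intro p hp
    rcases List.mem_cons.1 hp with rfl | hp
    · refine ⟨fun hmem => hxbr ?_, hJK hx, rfl⟩
      have := add_mem hmem (hwJ x hx)
      simpa only [mul_sub, sub_add_cancel, mul_assoc] using this
    · exact hl p hp
  · intro p hp u hu
    rcases List.mem_cons.1 hp with rfl | hp
    · change u * (b * r - w) ∈ T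
      rw [mul_sub, ← mul_assoc]
      exact sub_mem (mul_mem_of_rightIdeal T (hJ'b u hu) r) (hwJ u (hJ'J hu))
    · exact hs p hp u (hJ'J hu)

/-- In a ring with right Krull dimension every ideal contains a product of primes over it. -/
theorem primeProdKills_top (h : HasKdimO (Submodule Aᵐᵒᵖ A)) (hB : IsTwoSidedR B) :
    PrimeProdKills B B ⊤ := by
  by_contra hbad
  obtain ⟨α, hα⟩ := id h
  refine DevLE.not_rel_of_split α _ _ hα
    (fun I K => B ≤ I ∧ I ≤ K ∧ ¬ PrimeProdKills B I K) ?_ B ⊤ ⟨le_rfl, le_top, hbad⟩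
  rintro I K ⟨hBI, hIK, hn⟩
  refine ⟨lt_of_le_of_ne hIK fun heq => hn ?_, ?_⟩
  · subst heq
    exact ContainsPrimeProd.mono containsPrimeProd_top fun a _ k hk =>
      mul_mem_of_rightIdeal I hk a
  by_contra hns
  have hsup : ∀ {J J'}, PrimeProdKills B I J → PrimeProdKills B I J' →
      PrimeProdKills B I (J ⊔ J') := fun {J J'} h1 h2 => by
    refine ContainsPrimeProd.mul h1 h2 fun x hx y hy k hk => ?_
    obtain ⟨j, hj, j', hj', rfl⟩ := Submodule.mem_sup.1 hk
    rw [add_mul]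
    refine add_mem ?_ (isTwoSidedR_transporter y hy x j' hj')
    rw [← mul_assoc]
    exact mul_mem_of_rightIdeal I (hx j hj) y
  let T : Submodule Aᵐᵒᵖ A :=
    { carrier := {x | x ∈ K ∧ PrimeProdKills B I (Submodule.span Aᵐᵒᵖ {x})}
      add_mem' := fun {x y} hx hy => ⟨add_mem hx.1 hy.1, (hsup hx.2 hy.2).mono le_rfl <| by
        rw [Submodule.span_singleton_le_iff_mem]
        exact Submodule.add_mem_sup (Submodule.mem_span_singleton_self _)
          (Submodule.mem_span_singleton_self _)⟩
      zero_mem' := ⟨zero_mem _, ContainsPrimeProd.mono containsPrimeProd_top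
        fun a _ k hk => by
          rw [Submodule.span_zero_singleton, Submodule.mem_bot] at hk
          simp [hk]⟩
      smul_mem' := fun r x hx => ⟨K.smul_mem r hx.1, hx.2.mono le_rfl <| by
        rw [Submodule.span_singleton_le_iff_mem]
        exact Submodule.smul_mem _ _ (Submodule.mem_span_singleton_self _)⟩ }
  have hTK : T ≤ K := fun x hx => hx.1
  have hIT : I ≤ T := fun x hx => ⟨hIK hx, ContainsPrimeProd.mono containsPrimeProd_top
    fun a _ k hk => mul_mem_of_rightIdeal I
      ((Submodule.span_singleton_le_iff_mem x I).2 hx hk) a⟩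
  have hT : PrimeProdKills B I T := primeProdKills_of_torsion h hB hBI fun x hx => hx.2
  have hf : ∀ J ≤ K, PrimeProdKills B T J → J ≤ T := fun J hJ hk x hx =>
    ⟨hJ hx, (hT.trans hk).mono le_rfl ((Submodule.span_singleton_le_iff_mem x J).2 hx)⟩
  have hKT := le_of_torsionFree_of_quotients h hB (hBI.trans hIT) hTK hf
    fun J hJK hTJ hJT => by
      by_contra hbad'
      refine hns ⟨J, ⟨hBI, hIT.trans hTJ, fun hk => hJT ?_⟩,
        ⟨hBI.trans (hIT.trans hTJ), hJK, hbad'⟩⟩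
      exact hf J hJK (hk.mono hIT le_rfl)
  exact hn (hT.mono le_rfl hKT)

end PrimeProducts

theorem stmt16 (A : Type) [Ring A] (h : HasKdimO (Submodule Aᵐᵒᵖ A))
    (B : Submodule Aᵐᵒᵖ A) (hB2 : IsTwoSidedR B) (hBp : B ≠ ⊤) :
    ∃ (n : ℕ), 0 < n ∧ ∃ P : Fin n → Submodule Aᵐᵒᵖ A,
      (∀ i, IsPrime2 (P i)) ∧ (∀ i, B ≤ P i) ∧
      ∀ g : Fin n → A, (∀ i, g i ∈ P i) → (List.ofFn g).prod ∈ B := by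
  obtain ⟨L, hL, hg⟩ := primeProdKills_top h hB2
  refine ⟨L.length, ?_, L.get, fun i => (hL _ (L.get_mem i)).1,
    fun i => (hL _ (L.get_mem i)).2, fun g hgP => ?_⟩
  · rw [List.length_pos_iff]
    rintro rfl
    refine hBp (eq_top_iff.2 fun x _ => ?_)
    simpa using hg [] List.Forall₂.nil x trivial
  · have := hg (List.ofFn g) ?_ 1 trivial
    · simpa using this
    · rw [List.forall₂_iff_get]
      exact ⟨by simp, fun i h1 h2 => by simpa using hgP ⟨i, h2⟩⟩
end

section
/- Let A be a commutative arithmetical ring with no idempotent proper essential ideal, in which every factor ring is finite-dimensional, and let B be a proper ideal of A. Then there exist prime ideals P₁, ..., Pₖ of A, each containing B, and positive integers n₁, ..., nₖ, such that P₁^{n₁} ⋯ Pₖ^{nₖ} ⊆ B. -/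
open MulOpposite

/-- A commutative ring is arithmetical if its lattice of ideals is distributive. -/
def Arithmetical (A : Type) [CommRing A] : Prop :=
  ∀ I J K : Ideal A, I ⊓ (J ⊔ K) = I ⊓ J ⊔ I ⊓ K

/-- A commutative ring has no idempotent proper essential ideal. -/
def NoIdemEss (A : Type) [CommRing A] : Prop :=
  ∀ B : Ideal A, B ≠ ⊤ → (∀ C : Ideal A, C ≠ ⊥ → B ⊓ C ≠ ⊥) → B * B ≠ B

/-- The elements lying in `I` after multiplication by an element outside the prime `P`,
i.e. the contraction to `A` of the extension of `I` to the localization at `P`. -/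
def saturationAt {A : Type*} [CommRing A] (P : Ideal A) [P.IsPrime] (I : Ideal A) : Ideal A where
  carrier := {x | ∃ s, s ∉ P ∧ s * x ∈ I}
  zero_mem' := ⟨1, P.one_notMem, by simp⟩
  add_mem' := by
    rintro x y ⟨s, hs, hx⟩ ⟨t, ht, hy⟩
    refine ⟨s * t, fun h => (Ideal.IsPrime.mem_or_mem ‹_› h).elim hs ht, ?_⟩
    have h : s * t * (x + y) = t * (s * x) + s * (t * y) := by ring
    rw [h]
    exact I.add_mem (I.mul_mem_left _ hx) (I.mul_mem_left _ hy)
  smul_mem' := by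
    rintro c x ⟨s, hs, hx⟩
    refine ⟨s, hs, ?_⟩
    have h : s * (c • x) = c * (s * x) := by rw [smul_eq_mul]; ring
    rw [h]
    exact I.mul_mem_left _ hx

section Saturation

variable {A : Type*} [CommRing A]

theorem mul_le_saturationAt {P : Ideal A} [hP : P.IsPrime] {I I' J J' : Ideal A}
    (h : J ≤ saturationAt P I) (h' : J' ≤ saturationAt P I') :
    J * J' ≤ saturationAt P (I * I') := by
  rw [Ideal.mul_le]
  intro x hx y hy
  obtain ⟨s, hs, hsx⟩ := h hx
  obtain ⟨t, ht, hty⟩ := h' hy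
  refine ⟨s * t, fun h => (hP.mem_or_mem h).elim hs ht, ?_⟩
  rw [mul_mul_mul_comm]
  exact Ideal.mul_mem_mul hsx hty

theorem pow_le_saturationAt {P : Ideal A} [P.IsPrime] {I J : Ideal A}
    (h : J ≤ saturationAt P I) (n : ℕ) : J ^ n ≤ saturationAt P (I ^ n) := by
  induction n with
  | zero => exact fun x _ => ⟨1, P.one_notMem, by simp⟩
  | succ n ih => rw [pow_succ, pow_succ]; exact mul_le_saturationAt ih h

theorem exists_pow_mem_saturationAt {B P : Ideal A} [hP : P.IsPrime]
    (hPB : P ∈ B.minimalPrimes) {x : A} (hx : x ∈ P) : ∃ k : ℕ, x ^ k ∈ saturationAt P B := by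
  have h := IsLocalization.AtPrime.radical_map_of_mem_minimalPrimes
    (A := Localization.AtPrime P) P B hPB
  have hmem := Ideal.mem_map_of_mem (algebraMap A (Localization.AtPrime P)) hx
  rw [← h] at hmem
  obtain ⟨k, hk⟩ := hmem
  rw [← map_pow, IsLocalization.algebraMap_mem_map_algebraMap_iff P.primeCompl] at hk
  obtain ⟨s, hs, hsx⟩ := hk
  exact ⟨k, s, hs, hsx⟩

/-- Containment of ideals can be tested locally at the maximal ideals. -/
theorem le_of_forall_le_saturationAt {I J : Ideal A}
    (h : ∀ (m : Ideal A) [m.IsMaximal], I ≤ m → J ≤ saturationAt m I) : J ≤ I := by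
  intro x hx
  let K : Ideal A := Submodule.comap (LinearMap.mulRight A x) I
  have hK : ∀ t, t ∈ K ↔ t * x ∈ I := fun t => Iff.rfl
  have hIK : I ≤ K := fun t ht => I.mul_mem_right x ht
  by_contra hxI
  have hne : K ≠ ⊤ := by
    rw [Ideal.ne_top_iff_one, hK, one_mul]
    exact hxI
  obtain ⟨m, hm, hKm⟩ := Ideal.exists_le_maximal K hne
  obtain ⟨s, hs, hsx⟩ := h m (hIK.trans hKm) hx
  exact hs (hKm hsx)

end Saturation

/-- Localizations of an arithmetical ring at its primes are chained. -/
theorem Arithmetical.exists_notMem_dvd {A : Type} [CommRing A] (ha : Arithmetical A)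
    (P : Ideal A) [P.IsPrime] (a b : A) : ∃ s, s ∉ P ∧ (b ∣ s * a ∨ a ∣ s * b) := by
  have ha' := ha (Ideal.span {a}) (Ideal.span {b}) (Ideal.span {a - b})
  have hmem : a ∈ Ideal.span {a} ⊓ (Ideal.span {b} ⊔ Ideal.span {a - b}) := by
    refine ⟨Ideal.mem_span_singleton_self a, ?_⟩
    have h : a = b + (a - b) := by ring
    rw [SetLike.mem_coe, h]
    refine Submodule.add_mem_sup (Ideal.mem_span_singleton_self b) ?_
    rw [← h]
    exact Ideal.mem_span_singleton_self _
  rw [ha'] at hmem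
  obtain ⟨u, ⟨hua, hub⟩, v, ⟨-, hv⟩, huv⟩ := Submodule.mem_sup.mp hmem
  obtain ⟨r, rfl⟩ := Ideal.mem_span_singleton.mp hua
  obtain ⟨t, rfl⟩ := Ideal.mem_span_singleton.mp hv
  have hb : b ∣ a * r := Ideal.mem_span_singleton.mp hub
  by_cases hr : r ∈ P
  · by_cases ht : t ∈ P
    · refine ⟨t - 1 + r, fun h => P.one_notMem ?_, Or.inl ⟨t, by linear_combination huv⟩⟩
      have h1 : (1 : A) = t + r - (t - 1 + r) := by ring
      rw [h1]
      exact P.sub_mem (P.add_mem ht hr) h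
    · exact ⟨t, ht, Or.inr ⟨t - 1 + r, by linear_combination -huv⟩⟩
  · exact ⟨r, hr, Or.inl (by rwa [mul_comm])⟩

/-- If `P ≤ m` are primes and `s ∉ P`, then `P = s P` locally at `m`. -/
theorem Arithmetical.exists_mul_eq_mul {A : Type} [CommRing A] (ha : Arithmetical A)
    {P m : Ideal A} [hP : P.IsPrime] [m.IsPrime] (hPm : P ≤ m) {s y : A} (hs : s ∉ P)
    (hy : y ∈ P) : ∃ t, t ∉ m ∧ ∃ c ∈ P, t * y = s * c := by
  obtain ⟨t, ht, ⟨c, hc⟩ | hd⟩ := ha.exists_notMem_dvd m y s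
  · refine ⟨t, ht, c, ?_, hc⟩
    have h : s * c ∈ P := hc ▸ P.mul_mem_left t hy
    exact (hP.mem_or_mem h).resolve_left hs
  · have h : t * s ∈ P := P.mem_of_dvd hd hy
    exact absurd h fun h => (hP.mem_or_mem h).elim (fun h => ht (hPm h)) hs

/-- The square of an ideal `I ≤ P` that is contained in `B` locally at `P` is contained in `B`
locally at every prime above `P`. -/
theorem Arithmetical.mul_self_le_saturationAt {A : Type} [CommRing A] (ha : Arithmetical A)
    {P m : Ideal A} [P.IsPrime] [m.IsPrime] (hPm : P ≤ m) {I B : Ideal A}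
    (hIB : I ≤ saturationAt P B) (hIP : I ≤ P) : I * I ≤ saturationAt m B := by
  rw [Ideal.mul_le]
  intro a haI b hbI
  obtain ⟨s, hs, hsa⟩ := hIB haI
  obtain ⟨t, ht, c, -, htb⟩ := ha.exists_mul_eq_mul hPm hs (hIP hbI)
  refine ⟨t, ht, ?_⟩
  have h : t * (a * b) = s * a * c := by linear_combination a * htb
  rw [h]
  exact B.mul_mem_right c hsa

/-- A prime of an arithmetical ring without idempotent proper essential ideals is either zero
locally at itself, or not idempotent locally at itself. -/
theorem Arithmetical.not_le_saturationAt_mul_self {A : Type} [CommRing A] (ha : Arithmetical A)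
    (hni : NoIdemEss A) (P : Ideal A) [hP : P.IsPrime] (hne : ¬ P ≤ saturationAt P ⊥) :
    ¬ P ≤ saturationAt P (P * P) := by
  intro hsq
  obtain ⟨x₀, hx₀P, hx₀⟩ := SetLike.not_le_iff_exists.mp hne
  replace hx₀ : ∀ s, s ∉ P → s * x₀ ≠ 0 := fun s hs h => hx₀ ⟨s, hs, h⟩
  refine hni P hP.ne_top ?_ (le_antisymm Ideal.mul_le_left ?_)
  · intro C hC hPC
    obtain ⟨c, hcC, hc0⟩ := Submodule.exists_mem_ne_zero_of_ne_bot hC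
    have key : ∀ p ∈ P, c * p = 0 := fun p hp => by
      have h : c * p ∈ P ⊓ C := ⟨P.mul_mem_left c hp, C.mul_mem_right p hcC⟩
      rwa [hPC, Ideal.mem_bot] at h
    by_cases hcP : c ∈ P
    · have h : c ∈ P ⊓ C := ⟨hcP, hcC⟩
      rw [hPC, Ideal.mem_bot] at h
      exact hc0 h
    · exact hx₀ c hcP (key x₀ hx₀P)
  · refine le_of_forall_le_saturationAt fun m hm hPm x hx => ?_
    replace hPm : P ≤ m := fun y hy => (hm.isPrime.mem_or_mem (hPm (Ideal.mul_mem_mul hy hy))).elim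
      id id
    obtain ⟨s, hs, hsx⟩ := hsq hx
    obtain ⟨s₀, hs₀, hq⟩ := hsq hx₀P
    have hsat : P * P ≤ saturationAt m (Ideal.span {s} * (P * P)) := by
      have h : P ≤ saturationAt m (Ideal.span {s} * P) := fun y hy => by
        obtain ⟨t, ht, c, hc, h⟩ := ha.exists_mul_eq_mul hPm hs hy
        exact ⟨t, ht, h ▸ Ideal.mul_mem_mul (Ideal.mem_span_singleton_self s) hc⟩
      have h1 : P ≤ saturationAt m P := fun y hy => ⟨1, m.one_notMem, by simpa using hy⟩
      rw [← mul_assoc]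
      exact mul_le_saturationAt h h1
    obtain ⟨t, ht, hty⟩ := hsat hsx
    obtain ⟨z, hz, hsz⟩ := Ideal.mem_span_singleton_mul.mp hty
    have hw : s * (t * x - z) = 0 := by linear_combination -hsz
    obtain ⟨t', ht', hd | hd⟩ := ha.exists_notMem_dvd m (t * x - z) (s₀ * x₀)
    · refine ⟨t' * t, fun h => (hm.isPrime.mem_or_mem h).elim ht' ht, ?_⟩
      have h : t' * t * x = t' * (t * x - z) + t' * z := by ring
      rw [h]
      exact Ideal.add_mem _ (Ideal.mem_of_dvd _ hd hq) (Ideal.mul_mem_left _ _ hz)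
    · obtain ⟨c, hc⟩ := hd
      refine absurd ?_ (hx₀ (s * (t' * s₀)) fun h => ?_)
      · linear_combination s * hc + c * hw
      · rcases hP.mem_or_mem h with h | h
        · exact hs h
        · exact (hP.mem_or_mem h).elim (fun h => ht' (hPm h)) hs₀

/-- Some power of a minimal prime over `B` is contained in `B` locally at that prime. -/
theorem Arithmetical.exists_pow_le_saturationAt {A : Type} [CommRing A] (ha : Arithmetical A)
    (hni : NoIdemEss A) {B P : Ideal A} [hP : P.IsPrime] (hPB : P ∈ B.minimalPrimes) :
    ∃ n : ℕ, P ^ (n + 1) ≤ saturationAt P B := by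
  by_cases h0 : P ≤ saturationAt P ⊥
  · refine ⟨0, fun x hx => ?_⟩
    obtain ⟨s, hs, hsx⟩ := h0 (by simpa using hx)
    exact ⟨s, hs, bot_le (a := B) hsx⟩
  obtain ⟨x, hxP, hx⟩ :=
    SetLike.not_le_iff_exists.mp (ha.not_le_saturationAt_mul_self hni P h0)
  obtain ⟨k, s, hs, hsx⟩ := exists_pow_mem_saturationAt hPB hxP
  have hle : P * P ≤ saturationAt P (Ideal.span {x}) := fun y hy => by
    obtain ⟨t, ht, hd | hd⟩ := ha.exists_notMem_dvd P y x
    · exact ⟨t, ht, Ideal.mem_span_singleton.mpr hd⟩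
    · exact absurd ⟨t, ht, Ideal.mem_of_dvd _ hd hy⟩ hx
  refine ⟨2 * k, fun y hy => ?_⟩
  have hy' : y ∈ (P * P) ^ k := by
    rw [← pow_two, ← pow_mul]
    exact Ideal.pow_le_pow_right (Nat.le_succ _) hy
  obtain ⟨t, ht, hty⟩ := pow_le_saturationAt hle k hy'
  rw [Ideal.span_singleton_pow, Ideal.mem_span_singleton] at hty
  refine ⟨s * t, fun h => (hP.mem_or_mem h).elim hs ht, ?_⟩
  rw [mul_assoc]
  exact Ideal.mem_of_dvd _ (mul_dvd_mul_left s hty) hsx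

/-- If the factor ring by the radical of `B` is finite-dimensional, then there are only finitely
many minimal primes over `B`. -/
theorem finite_minimalPrimes_of_finDimL {A : Type} [CommRing A] (B : Ideal A)
    (hfd : FinDimL (Ideal (A ⧸ B.radical))) : B.minimalPrimes.Finite := by
  by_contra hinf
  let X : Set (PrimeSpectrum A) := {p | p.asIdeal ∈ B.minimalPrimes}
  have hX : Infinite X := by
    refine Set.infinite_coe_iff.mpr fun hfin => hinf ((hfin.image PrimeSpectrum.asIdeal).subset ?_)
    exact fun p hp => ⟨⟨p, hp.1.1⟩, hp, rfl⟩
  have hT2 : T2Space X := by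
    refine ⟨fun p q hpq => ?_⟩
    have hnle : ¬ p.1.asIdeal ≤ q.1.asIdeal := fun h =>
      hpq (Subtype.ext (PrimeSpectrum.ext (le_antisymm h (q.2.2 p.2.1 h))))
    obtain ⟨x, hxp, hxq⟩ := SetLike.not_le_iff_exists.mp hnle
    obtain ⟨k, s, hs, hsx⟩ := exists_pow_mem_saturationAt p.2 hxp
    refine ⟨Subtype.val ⁻¹' (PrimeSpectrum.basicOpen s : Set (PrimeSpectrum A)),
      Subtype.val ⁻¹' (PrimeSpectrum.basicOpen x : Set (PrimeSpectrum A)),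
      (PrimeSpectrum.basicOpen s).isOpen.preimage continuous_subtype_val,
      (PrimeSpectrum.basicOpen x).isOpen.preimage continuous_subtype_val, hs, hxq, ?_⟩
    rw [Set.disjoint_left]
    intro r hrs hrx
    rcases r.1.2.mem_or_mem (r.2.1.2 hsx) with h | h
    · exact hrs h
    · exact hrx (r.1.2.mem_of_pow_mem k h)
  obtain ⟨U, hUinf, hUo, hUd⟩ := exists_seq_infinite_isOpen_pairwise_disjoint X
  have hbasic : ∀ n, ∃ x : A, x ∉ B.radical ∧ ∀ p : X, x ∉ p.1.asIdeal → p ∈ U n := fun n => by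
    obtain ⟨p, hp⟩ := (hUinf n).nonempty
    obtain ⟨V, hV, hVU⟩ := isOpen_induced_iff.mp (hUo n)
    have hpV : p.1 ∈ V := by rwa [← hVU] at hp
    obtain ⟨_, ⟨x, rfl⟩, hpx, hxV⟩ :=
      PrimeSpectrum.isTopologicalBasis_basic_opens.exists_subset_of_mem_open hpV hV
    refine ⟨x, fun h => hpx (p.1.2.radical_le_iff.mpr p.2.1.2 h), fun q hq => ?_⟩
    rw [← hVU]
    exact hxV hq
  choose x hx hxU using hbasic
  have hmul : ∀ i j, i ≠ j → x i * x j ∈ B.radical := fun i j hij => by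
    rw [← Ideal.sInf_minimalPrimes, Submodule.mem_sInf]
    intro p hp
    have := hp.1.1
    by_contra h
    exact Set.disjoint_left.mp (hUd hij)
      (hxU i ⟨⟨p, hp.1.1⟩, hp⟩ fun hi => h (Ideal.mul_mem_right _ p hi))
      (hxU j ⟨⟨p, hp.1.1⟩, hp⟩ fun hj => h (Ideal.mul_mem_left p _ hj))
  have hred : IsReduced (A ⧸ B.radical) :=
    (Ideal.isRadical_iff_quotient_reduced _).mp (Ideal.radical_isRadical B)
  let f : ℕ → Ideal (A ⧸ B.radical) := fun n => Ideal.span {Ideal.Quotient.mk _ (x n)}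
  refine hfd ⟨f, fun n hn => hx n ?_, fun n => ?_⟩
  · rwa [Ideal.span_singleton_eq_bot, Ideal.Quotient.eq_zero_iff_mem] at hn
  · have hann : f n * (⨆ m, ⨆ _ : m ≠ n, f m) = ⊥ := by
      simp only [Ideal.mul_iSup, iSup_eq_bot]
      intro m hm
      rw [Ideal.span_singleton_mul_span_singleton, Ideal.span_singleton_eq_bot, ← map_mul,
        Ideal.Quotient.eq_zero_iff_mem]
      exact hmul n m hm.symm
    refine eq_bot_iff.mpr fun y hy => ?_
    have hyy := Ideal.mul_mem_mul hy.1 hy.2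
    rw [hann, Ideal.mem_bot] at hyy
    exact IsReduced.eq_zero y ⟨2, by rw [pow_two, hyy]⟩

theorem stmt19 (A : Type) [CommRing A] (ha : Arithmetical A)
    (hni : NoIdemEss A)
    (hfd : ∀ I : Ideal A, FinDimL (Ideal (A ⧸ I)))
    (B : Ideal A) (hB : B ≠ ⊤) :
    ∃ (k : ℕ), 0 < k ∧ ∃ (P : Fin k → Ideal A) (n : Fin k → ℕ),
      (∀ i, (P i).IsPrime) ∧ (∀ i, B ≤ P i) ∧ (∀ i, 0 < n i) ∧
      (∏ i : Fin k, P i ^ n i) ≤ B := by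
  have := (finite_minimalPrimes_of_finDimL B (hfd _)).to_subtype
  have hne : Nonempty B.minimalPrimes := Ideal.nonempty_minimalPrimes hB
  obtain ⟨k, ⟨e⟩⟩ := Finite.exists_equiv_fin B.minimalPrimes
  let P : Fin k → Ideal A := fun i => (e.symm i : Ideal A)
  have hmin : ∀ i, P i ∈ B.minimalPrimes := fun i => (e.symm i).2
  have hP : ∀ i, (P i).IsPrime := fun i => (hmin i).1.1
  choose n hn using fun i => ha.exists_pow_le_saturationAt hni (hmin i)
  refine ⟨k, (e hne.some).pos, P, fun i => n i + 1 + (n i + 1), hP, fun i => (hmin i).1.2,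
    fun i => Nat.succ_pos _, le_of_forall_le_saturationAt fun m hm hBm => ?_⟩
  obtain ⟨Q, hQ, hQm⟩ := Ideal.exists_minimalPrimes_le hBm
  obtain ⟨i, rfl⟩ : ∃ i, P i = Q := ⟨e ⟨Q, hQ⟩, by simp [P]⟩
  refine le_trans (Ideal.le_of_dvd (Finset.dvd_prod_of_mem _ (Finset.mem_univ i))) ?_
  rw [pow_add]
  exact ha.mul_self_le_saturationAt hQm (hn i) (Ideal.pow_le_self (n i).succ_ne_zero)
end
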